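/- Let d ≥ 3, u > 0, γ ∈ (0,1), and let s be a positive integer. There exist constants c = c(d,u,s,γ) > 0 and C = C(d,u,s,γ) < ∞ such that for every x ∈ Z^d and every positive integer T, the recursively defined random sets U^{(1)}, ..., U^{(s)} satisfy P[ ∪_{i=1}^s U^{(i)} ⊆ B(x, s T^{(1+γ)/2}) ] ≥ 1 − C exp(−c T^γ). -/

import Mathlib

open MeasureTheory ProbabilityTheory
open scoped ENNReal NNReal

/-- Points of the lattice `ℤ^d`. -/
abbrev Zd (d : ℕ) := Fin d → ℤ

/-- The `ℓ^∞` norm of a lattice point. -/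
def norminf {d : ℕ} (x : Zd d) : ℕ := Finset.univ.sup fun j => (x j).natAbs

/-- `x` and `y` are nearest neighbours in `ℤ^d` (their `ℓ^1` distance is `1`). -/
def IsStep {d : ℕ} (x y : Zd d) : Prop := (∑ j, (y j - x j).natAbs) = 1

/-- Discrete ball (in `ℤ^d`, `ℓ^∞` distance) with real center and radius. -/
def ballZR (d : ℕ) (c : Fin d → ℝ) (r : ℝ) : Set (Zd d) :=
  {y | ∀ j, |(y j : ℝ) - c j| ≤ r}

/-- `t`-step transition probability of simple random walk on `ℤ^d`. -/
noncomputable def stepP (d : ℕ) : ℕ → Zd d → Zd d → ℝ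
  | 0, x, y => if x = y then 1 else 0
  | n+1, x, y => (∑ j : Fin d,
      (stepP d n (Function.update x j (x j + 1)) y +
       stepP d n (Function.update x j (x j - 1)) y)) / (2 * d)

/-- The Green function of simple random walk on `ℤ^d`. -/
noncomputable def green (d : ℕ) (x y : Zd d) : ℝ := ∑' n : ℕ, stepP d n x y

/-- The energy of a (finitely supported) measure `ν`, carried by the finite set `s`. -/
noncomputable def energy (d : ℕ) (s : Finset (Zd d)) (ν : Zd d → ℝ) : ℝ :=
  ∑ z ∈ s, ∑ w ∈ s, green d z w * ν z * ν w

/-- The capacity of `K ⊆ ℤ^d`: the inverse of the infimum of the energies of probability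
measures carried by `K` (with the conventions `sInf ∅ = 0`, `0⁻¹ = 0`, this gives
`capacity d ∅ = 0`). -/
noncomputable def capacity (d : ℕ) (K : Set (Zd d)) : ℝ :=
  (sInf {E : ℝ | ∃ (s : Finset (Zd d)) (ν : Zd d → ℝ), ↑s ⊆ K ∧
    (∀ z, 0 ≤ ν z) ∧ (∀ z ∉ s, ν z = 0) ∧ (∑ z ∈ s, ν z) = 1 ∧ E = energy d s ν})⁻¹

open Classical in
/-- `X` is a simple random walk on `ℤ^d` started at `x0`, under the probability measure `P`:
a walk follows nearest-neighbour paths, each of the `(2d)^n` admissible length-`n` paths from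
`x0` having probability `(2d)⁻ⁿ`. -/
def IsSRW (d : ℕ) {Ω : Type} [MeasurableSpace Ω] (P : Measure Ω)
    (X : ℕ → Ω → Zd d) (x0 : Zd d) : Prop :=
  (∀ t, Measurable (X t)) ∧
  ∀ (n : ℕ) (w : ℕ → Zd d),
    P {ω | ∀ k ≤ n, X k ω = w k} =
      if w 0 = x0 ∧ ∀ k < n, IsStep (w k) (w (k+1))
      then ((2 * d : ℝ≥0∞))⁻¹ ^ n else 0

/-- The set `Φ(X̄_N, T)`: all points visited by the walks `X 0, …, X (N-1)` during times
`1, …, T`. -/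
def Phi (d : ℕ) {Ω : Type} (X : ℕ → ℕ → Ω → Zd d) (N T : ℕ) (ω : Ω) : Set (Zd d) :=
  {z | ∃ i < N, ∃ t, 1 ≤ t ∧ t ≤ T ∧ X i t ω = z}

/-- The function `F(n,d)` : `√n` for `d = 3`, `log n` for `d = 4`, and `1` for `d ≥ 5`. -/
noncomputable def Ffn (d n : ℕ) : ℝ :=
  if d = 3 then Real.sqrt n else if d = 4 then Real.log n else 1
open Classical in
/-- `escProb d A n z` is the probability that a simple random walk started at `z` stays
outside `A` at all times `1, …, n`. -/
noncomputable def escProb (d : ℕ) (A : Set (Zd d)) : ℕ → Zd d → ℝ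
  | 0, _ => 1
  | n+1, z => (∑ j : Fin d,
      ((if Function.update z j (z j + 1) ∈ A then 0
        else escProb d A n (Function.update z j (z j + 1))) +
       (if Function.update z j (z j - 1) ∈ A then 0
        else escProb d A n (Function.update z j (z j - 1))))) / (2 * d)

open Classical in
/-- The equilibrium measure of `A`: `e_A(z) = P_z[X(t) ∉ A for all t ≥ 1]` for `z ∈ A`,
and `0` otherwise. -/
noncomputable def eqMeasure (d : ℕ) (A : Set (Zd d)) (z : Zd d) : ℝ :=
  if z ∈ A then ⨅ n : ℕ, escProb d A n z else 0

/-- The normalized equilibrium measure `ẽ_A = e_A / cap(A)`. -/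
noncomputable def neqMeasure (d : ℕ) (A : Set (Zd d)) (z : Zd d) : ℝ :=
  eqMeasure d A z / capacity d A

/-- The Poisson(`lam`) probability of the value `n`. -/
noncomputable def poissonProb (lam : ℝ) (n : ℕ) : ℝ :=
  Real.exp (-lam) * lam ^ n / n.factorial

open Classical in
/-- The probability that a simple random walk whose starting point has (sub-)probability
density `ν` follows the path `w 0, w 1, …, w m` during its first `m` steps. -/
noncomputable def pathProb (d : ℕ) (ν : Zd d → ℝ) (m : ℕ) (w : ℕ → Zd d) : ℝ :=
  if ∀ k < m, IsStep (w k) (w (k+1)) then ν (w 0) * ((2 * (d : ℝ)))⁻¹ ^ m else 0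

/-- Under `P`, `N` is Poisson with parameter `u ⬝ cap K` and, given `N`, the walks
`Y 0, …, Y (N-1)` are independent simple random walks whose starting points are i.i.d.
with distribution the normalized equilibrium measure of `K`. -/
def HasLevelLaw (d : ℕ) (u : ℝ) {Ω : Type} [MeasurableSpace Ω] (P : Measure Ω)
    (K : Set (Zd d)) (N : Ω → ℕ) (Y : ℕ → ℕ → Ω → Zd d) : Prop :=
  (∀ i t, Measurable (Y i t)) ∧ Measurable N ∧
  ∀ (n m : ℕ) (w : ℕ → ℕ → Zd d),
    P {ω | N ω = n ∧ ∀ k < n, ∀ t ≤ m, Y k t ω = w k t} =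
      ENNReal.ofReal (poissonProb (u * capacity d K) n *
        ∏ k ∈ Finset.range n, pathProb d (neqMeasure d K) m (w k))

/-- The recursively defined random sets `U⁽ⁱ⁾ = U⁽ⁱ⁾(x,T)`: `U⁽¹⁾` is the range of the walk
`X` during times `1, …, T`, and for `i ≥ 2`, `U⁽ⁱ⁾` is the set of points visited, during times
`1, …, T`, by the `N i` walks `Y i 0, …, Y i (N i - 1)`. -/
def Uset (d T : ℕ) {Ω : Type} (X : ℕ → Ω → Zd d) (N : ℕ → Ω → ℕ)
    (Y : ℕ → ℕ → ℕ → Ω → Zd d) (i : ℕ) (ω : Ω) : Set (Zd d) :=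
  if i ≤ 1 then {z | ∃ t, 1 ≤ t ∧ t ≤ T ∧ X t ω = z}
  else {z | ∃ k < N i ω, ∃ t, 1 ≤ t ∧ t ≤ T ∧ Y i k t ω = z}
/-- signed unit vector -/
def stepVec {d : ℕ} (a : Fin d × Bool) : Zd d := Pi.single a.1 (if a.2 then 1 else -1)

/-- path from `z` with steps `s` -/
def pathOf {d T : ℕ} (z : Zd d) (s : Fin T → Fin d × Bool) : Fin (T+1) → Zd d :=
  fun t => z + ∑ i : Fin T, if (i:ℕ) < (t:ℕ) then stepVec (s i) else 0

/-- extension of a finite path -/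
def extPath {d T : ℕ} (p : Fin (T+1) → Zd d) : ℕ → Zd d := fun t => p (Fin.ofNat (T+1) t)

lemma extPath_of_le {d T : ℕ} (p : Fin (T+1) → Zd d) (t : ℕ) (ht : t ≤ T) :
    extPath p t = p ⟨t, Nat.lt_succ_of_le ht⟩ := by
  unfold extPath
  congr 1
  ext
  simp [Fin.ofNat, Nat.mod_eq_of_lt (Nat.lt_succ_of_le ht)]

lemma isStep_exists {d : ℕ} {x y : Zd d} (h : IsStep x y) : ∃ a, y = x + stepVec a := by
  unfold IsStep at h
  have hne : ∃ j, (y j - x j).natAbs ≠ 0 := by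
    by_contra! hc
    simp [hc] at h
  obtain ⟨j, hj⟩ := hne
  rw [← Finset.add_sum_erase _ _ (Finset.mem_univ j)] at h
  have h1 : (y j - x j).natAbs = 1 := by omega
  have h2 : ∑ k ∈ Finset.univ.erase j, (y k - x k).natAbs = 0 := by omega
  rw [Finset.sum_eq_zero_iff] at h2
  have h3 : y j - x j = 1 ∨ y j - x j = -1 := by omega
  have h4 : ∀ k, k ≠ j → y k = x k := by
    intro k hk
    have := h2 k (by simp [hk])
    omega
  rcases h3 with h3 | h3
  · refine ⟨(j, true), ?_⟩
    funext k
    by_cases hk : k = j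
    · subst hk; simp [stepVec]; omega
    · simp [stepVec, hk, h4 k hk]
  · refine ⟨(j, false), ?_⟩
    funext k
    by_cases hk : k = j
    · subst hk; simp [stepVec]; omega
    · simp [stepVec, hk, h4 k hk]

lemma exists_pathOf {d T : ℕ} (p : Fin (T+1) → Zd d)
    (h : ∀ k < T, IsStep (extPath p k) (extPath p (k+1))) :
    ∃ s, p = pathOf (p 0) s := by
  have h' : ∀ i : Fin T, ∃ a, extPath p (i+1) = extPath p i + stepVec a :=
    fun i => isStep_exists (h i i.2)
  choose s hs using h'
  refine ⟨s, ?_⟩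
  have key : ∀ t, t ≤ T → extPath p t = p 0 + ∑ i : Fin T, if (i:ℕ) < t then stepVec (s i) else 0 := by
    intro t
    induction t with
    | zero => intro _; simp [extPath_of_le]
    | succ t ih =>
      intro ht
      have := hs ⟨t, ht⟩
      simp only at this
      rw [this, ih (by omega), add_assoc]
      congr 1
      have e : stepVec (s ⟨t, ht⟩) = ∑ i : Fin T, if i = ⟨t, ht⟩ then stepVec (s i) else 0 := by
        simp
      rw [e, ← Finset.sum_add_distrib]
      refine Finset.sum_congr rfl fun i _ => ?_
      rcases lt_trichotomy (i:ℕ) t with hi | hi | hi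
      · have : i ≠ ⟨t, ht⟩ := by intro hh; simp [hh] at hi
        simp [hi, this, Nat.lt_succ_of_lt hi]
      · have : i = ⟨t, ht⟩ := Fin.ext hi
        simp [this]
      · have : i ≠ ⟨t, ht⟩ := by intro hh; simp [hh] at hi
        have h5 : ¬ ((i:ℕ) < t) := by omega
        have h6 : ¬ ((i:ℕ) < t + 1) := by omega
        simp [h5, h6, this]
  funext t
  have := key t (Nat.le_of_lt_succ t.2)
  rw [extPath_of_le _ _ (Nat.le_of_lt_succ t.2)] at this
  simpa [pathOf] using this

/-- bad paths (relative displacement larger than `r`, or start outside `K`) -/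
def badPaths (d T : ℕ) (K : Set (Zd d)) (r : ℝ) : Set (Fin (T+1) → Zd d) :=
  {p | p 0 ∉ K ∨ ∃ t j, r < |((p t j : ℤ) : ℝ) - p 0 j|}

lemma pathOf_zero {d T : ℕ} (z : Zd d) (s : Fin T → Fin d × Bool) : pathOf z s 0 = z := by
  simp [pathOf]

lemma sum_step_exp (d : ℕ) (j : Fin d) (θ : ℝ) :
    ∑ a : Fin d × Bool, Real.exp (θ * (stepVec a j : ℤ)) ≤ 2 * d * Real.exp (θ^2/2) := by
  rw [Fintype.sum_prod_type]
  have h1 : 1 ≤ Real.exp (θ^2/2) := Real.one_le_exp (by positivity)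
  have : ∀ i : Fin d, ∑ b : Bool, Real.exp (θ * (stepVec (i, b) j : ℤ)) ≤ 2 * Real.exp (θ^2/2) := by
    intro i
    by_cases hi : j = i
    · subst hi
      have := Real.cosh_le_exp_half_sq θ
      rw [Real.cosh_eq] at this
      simp [stepVec]
      linarith
    · simp [stepVec, hi]
      positivity
  calc _ ≤ ∑ i : Fin d, 2 * Real.exp (θ^2/2) := Finset.sum_le_sum fun i _ => this i
    _ = _ := by simp; ring

open Classical in
lemma card_dev (d T : ℕ) (hT : 1 ≤ T) (j : Fin d) (t : Fin (T+1)) (r : ℝ) (hr : 0 ≤ r) (ε : ℝ)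
    (hε : ε = 1 ∨ ε = -1) :
    ((Finset.univ.filter fun s : Fin T → Fin d × Bool =>
      r < ε * (((∑ i : Fin T, if (i:ℕ) < (t:ℕ) then stepVec (s i) else 0 : Zd d) j : ℤ) : ℝ)).card : ℝ)
      ≤ (2 * d : ℝ)^T * Real.exp (- r^2 / (2 * T)) := by
  set θ : ℝ := r / T with hθ
  have hT0 : (0:ℝ) < T := by exact_mod_cast hT
  have hθ0 : 0 ≤ θ := by positivity
  have hε2 : (θ * ε)^2 = θ^2 := by rcases hε with h | h <;> simp [h]
  set D : (Fin T → Fin d × Bool) → ℝ := fun s =>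
    (((∑ i : Fin T, if (i:ℕ) < (t:ℕ) then stepVec (s i) else 0 : Zd d) j : ℤ) : ℝ) with hD
  have hexp : ∀ s, Real.exp (θ * ε * D s) =
      ∏ i : Fin T, (if (i:ℕ) < (t:ℕ) then Real.exp (θ * ε * (stepVec (s i) j : ℤ)) else 1) := by
    intro s
    rw [hD]
    simp only [Finset.sum_apply, Int.cast_sum, Finset.mul_sum, Real.exp_sum]
    refine Finset.prod_congr rfl fun i _ => ?_
    split_ifs <;> simp
  have hsum : ∑ s, Real.exp (θ * ε * D s) ≤ (2 * d * Real.exp (θ^2/2))^T := by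
    simp only [hexp]
    rw [← Fintype.prod_sum (fun (i : Fin T) (a : Fin d × Bool) =>
      (if (i:ℕ) < (t:ℕ) then Real.exp (θ * ε * (stepVec a j : ℤ)) else 1))]
    calc _ ≤ ∏ i : Fin T, (2 * d * Real.exp (θ^2/2)) := by
          refine Finset.prod_le_prod (fun i _ => Finset.sum_nonneg fun a _ => ?_) fun i _ => ?_
          · split_ifs <;> positivity
          · split_ifs
            · have := sum_step_exp d j (θ * ε)
              rwa [hε2] at this
            · have h1 : 1 ≤ Real.exp (θ^2/2) := Real.one_le_exp (by positivity)
              simp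
              nlinarith [(Nat.cast_nonneg d : (0:ℝ) ≤ d)]
      _ = _ := by simp
  have hlow : ((Finset.univ.filter fun s => r < ε * D s).card : ℝ) * Real.exp (θ * r)
      ≤ ∑ s, Real.exp (θ * ε * D s) := by
    calc _ = ∑ s ∈ Finset.univ.filter (fun s => r < ε * D s), Real.exp (θ * r) := by simp
      _ ≤ ∑ s ∈ Finset.univ.filter (fun s => r < ε * D s), Real.exp (θ * ε * D s) := by
          refine Finset.sum_le_sum fun s hs => Real.exp_le_exp.mpr ?_
          have := (Finset.mem_filter.mp hs).2
          rw [mul_assoc]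
          gcongr
      _ ≤ _ := Finset.sum_le_sum_of_subset_of_nonneg (Finset.filter_subset _ _)
          fun _ _ _ => (Real.exp_pos _).le
  have h3 := hlow.trans hsum
  rw [mul_pow, ← Real.exp_nat_mul] at h3
  have h4 : Real.exp (T * (θ^2/2)) = Real.exp (-r^2/(2*T)) * Real.exp (θ * r) := by
    rw [← Real.exp_add]
    congr 1
    rw [hθ]; field_simp; ring
  rw [h4, ← mul_assoc] at h3
  exact le_of_mul_le_mul_right h3 (Real.exp_pos _)

open Classical in
lemma card_bad (d T : ℕ) (hT : 1 ≤ T) (K : Set (Zd d)) (z : Zd d) (hz : z ∈ K) (r : ℝ) (hr : 0 ≤ r) :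
    ((Finset.univ.filter fun s : Fin T → Fin d × Bool => pathOf z s ∈ badPaths d T K r).card : ℝ)
      ≤ (2 * d : ℝ)^T * (2 * d * (T+1) * Real.exp (- r^2 / (2 * T))) := by
  set F : Fin (T+1) → Fin d → ℝ → Finset (Fin T → Fin d × Bool) := fun t j ε =>
    Finset.univ.filter fun s =>
      r < ε * (((∑ i : Fin T, if (i:ℕ) < (t:ℕ) then stepVec (s i) else 0 : Zd d) j : ℤ) : ℝ) with hF
  have hsub : (Finset.univ.filter fun s : Fin T → Fin d × Bool => pathOf z s ∈ badPaths d T K r) ⊆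
      Finset.univ.biUnion fun t => Finset.univ.biUnion fun j => F t j 1 ∪ F t j (-1) := by
    intro s hs
    have hs := (Finset.mem_filter.mp hs).2
    rcases hs with hs | ⟨t, j, h⟩
    · rw [pathOf_zero] at hs; exact absurd hz hs
    · rw [pathOf_zero] at h
      simp only [Finset.mem_biUnion, Finset.mem_union, Finset.mem_univ, true_and]
      refine ⟨t, j, ?_⟩
      rw [lt_abs] at h
      simp only [hF, Finset.mem_filter, Finset.mem_univ, true_and]
      simp only [pathOf, Pi.add_apply, Int.cast_add] at h
      rcases h with h | h
      · left; linarith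
      · right; linarith
  have hc : ((Finset.univ.biUnion fun t => Finset.univ.biUnion fun j => F t j 1 ∪ F t j (-1)).card : ℝ)
      ≤ ∑ t : Fin (T+1), ∑ j : Fin d, (2 * ((2 * d : ℝ)^T * Real.exp (- r^2 / (2 * T)))) := by
    refine (Nat.cast_le.mpr Finset.card_biUnion_le).trans ?_
    rw [Nat.cast_sum]
    refine Finset.sum_le_sum fun t _ => ?_
    refine (Nat.cast_le.mpr Finset.card_biUnion_le).trans ?_
    rw [Nat.cast_sum]
    refine Finset.sum_le_sum fun j _ => ?_
    refine (Nat.cast_le.mpr (Finset.card_union_le _ _)).trans ?_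
    rw [Nat.cast_add, two_mul]
    exact add_le_add (card_dev d T hT j t r hr 1 (by simp)) (card_dev d T hT j t r hr (-1) (by simp))
  refine (Nat.cast_le.mpr (Finset.card_le_card hsub)).trans (hc.trans (le_of_eq ?_))
  simp
  ring
/-- law of the first `T` steps of a walk with starting density `ν` -/
noncomputable def pathMeas (d T : ℕ) (ν : Zd d → ℝ) : Measure (Fin (T+1) → Zd d) :=
  Measure.sum fun p => ENNReal.ofReal (pathProb d ν T (extPath p)) • Measure.dirac p

lemma pathMeas_singleton (d T : ℕ) (ν : Zd d → ℝ) (p : Fin (T+1) → Zd d) :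
    pathMeas d T ν {p} = ENNReal.ofReal (pathProb d ν T (extPath p)) := by
  rw [pathMeas, Measure.sum_apply _ (measurableSet_singleton p), tsum_eq_single p]
  · simp
  · intro q hq
    simp [hq]

open Classical in
lemma pathMeas_le (d T : ℕ) (ν : Zd d → ℝ) (K : Finset (Zd d))
    (hK : ∀ z ∉ K, ν z = 0) (A : Set (Fin (T+1) → Zd d)) (b : ℝ)
    (hb : ∀ z ∈ K, ((Finset.univ.filter fun s : Fin T → Fin d × Bool => pathOf z s ∈ A).card : ℝ)
      ≤ (2 * d : ℝ)^T * b) (hd : 1 ≤ d) :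
    pathMeas d T ν A ≤ (∑ z ∈ K, ENNReal.ofReal (ν z)) * ENNReal.ofReal b := by
  set c : ℝ≥0∞ := ENNReal.ofReal ((2 * (d:ℝ))⁻¹ ^ T) with hc
  set ρ : Measure (Fin (T+1) → Zd d) := ∑ z ∈ K, ∑ s : Fin T → Fin d × Bool,
    (ENNReal.ofReal (ν z) * c) • Measure.dirac (pathOf z s) with hρ
  have hle : pathMeas d T ν ≤ ρ := by
    rw [Measure.le_iff]
    intro S hS
    have h1 : ∀ m : Measure (Fin (T+1) → Zd d), m S = ∑' p : S, m {(p : Fin (T+1) → Zd d)} := by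
      intro m
      rw [Measure.tsum_indicator_apply_singleton m S hS |>.symm, ← tsum_subtype]
    rw [h1, h1]
    refine ENNReal.tsum_le_tsum fun p => ?_
    rw [pathMeas_singleton]
    unfold pathProb
    split_ifs with hstep
    · obtain ⟨s, hs⟩ := exists_pathOf p.1 hstep
      by_cases hz : p.1 0 ∈ K
      · rw [hρ, Measure.finsetSum_apply]
        refine le_trans ?_ (Finset.single_le_sum (fun _ _ => zero_le) hz)
        rw [Measure.finsetSum_apply]
        refine le_trans ?_ (Finset.single_le_sum (fun _ _ => zero_le) (Finset.mem_univ s))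
        rw [Measure.smul_apply, ← hs]
        simp only [measurableSet_singleton, Measure.dirac_apply', Set.indicator_of_mem, Set.mem_singleton_iff, Pi.one_apply, smul_eq_mul, mul_one]
        rw [ENNReal.ofReal_mul' (by positivity), extPath_of_le _ _ (Nat.zero_le _)]
        rfl
      · have : ν (extPath p.1 0) = 0 := by
          rw [extPath_of_le _ _ (Nat.zero_le _)]
          exact hK _ hz
        simp [this]
    · simp
  refine (hle A).trans ?_
  rw [hρ, Measure.finsetSum_apply, Finset.sum_mul]
  refine Finset.sum_le_sum fun z hz => ?_
  rw [Measure.finsetSum_apply]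
  have : ∀ s : Fin T → Fin d × Bool, ((ENNReal.ofReal (ν z) * c) • Measure.dirac (pathOf z s)) A =
      if pathOf z s ∈ A then (ENNReal.ofReal (ν z) * c) else 0 := by
    intro s
    by_cases h : pathOf z s ∈ A <;> simp [h]
  simp only [this]
  rw [← Finset.sum_filter, Finset.sum_const, nsmul_eq_mul, mul_comm, mul_assoc]
  gcongr
  rw [hc, ← ENNReal.ofReal_natCast, ← ENNReal.ofReal_mul (by positivity)]
  refine ENNReal.ofReal_le_ofReal ?_
  have hd0 : (0:ℝ) < d := by exact_mod_cast hd
  rw [inv_pow, inv_mul_le_iff₀ (by positivity)]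
  exact hb z hz

lemma pathMeas_univ_le (d T : ℕ) (ν : Zd d → ℝ) (K : Finset (Zd d))
    (hK : ∀ z ∉ K, ν z = 0) (hd : 1 ≤ d) :
    pathMeas d T ν Set.univ ≤ (∑ z ∈ K, ENNReal.ofReal (ν z)) := by
  have := pathMeas_le d T ν K hK Set.univ 1 (by
    intro z hz
    simp [mul_comm]) hd
  simpa using this

lemma pathMeas_bad_le (d T : ℕ) (hT : 1 ≤ T) (ν : Zd d → ℝ) (K : Finset (Zd d))
    (hK : ∀ z ∉ K, ν z = 0) (hd : 1 ≤ d) (r : ℝ) (hr : 0 ≤ r) :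
    pathMeas d T ν (badPaths d T K r) ≤ (∑ z ∈ K, ENNReal.ofReal (ν z)) *
      ENNReal.ofReal (2 * d * (T+1) * Real.exp (- r^2 / (2 * T))) := by
  classical
  refine pathMeas_le d T ν K hK _ _ ?_ hd
  intro z hz
  convert card_bad d T hT K z hz r hr

lemma law_ext {Ω α : Type} [MeasurableSpace Ω] [MeasurableSpace α] [Countable α]
    [MeasurableSingletonClass α] (Q : Measure Ω) (E : Set Ω) 
    (Z : Ω → α) (hZ : Measurable Z) (m : Measure α) (h : ∀ a, Q (E ∩ {ω | Z ω = a}) = m {a})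
    (A : Set α) : Q (E ∩ {ω | Z ω ∈ A}) = m A := by
  have : (Q.restrict E).map Z = m := by
    refine Measure.ext_of_singleton fun a => ?_
    rw [Measure.map_apply hZ (measurableSet_singleton a),
      Measure.restrict_apply (hZ (measurableSet_singleton a)), ← h a, Set.inter_comm]
    rfl
  have hA : MeasurableSet A := A.to_countable.measurableSet
  rw [← this, Measure.map_apply hZ hA, Measure.restrict_apply (hZ hA), Set.inter_comm]
  rfl

lemma escProb_nonneg (d : ℕ) (A : Set (Zd d)) (n : ℕ) (z : Zd d) : 0 ≤ escProb d A n z := by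
  induction n generalizing z with
  | zero => simp [escProb]
  | succ n ih =>
    unfold escProb
    refine div_nonneg (Finset.sum_nonneg fun j _ => add_nonneg ?_ ?_) (by positivity)
    · split_ifs
      · exact le_rfl
      · exact ih _
    · split_ifs
      · exact le_rfl
      · exact ih _

lemma eqMeasure_nonneg (d : ℕ) (A : Set (Zd d)) (z : Zd d) : 0 ≤ eqMeasure d A z := by
  unfold eqMeasure
  split_ifs
  · exact Real.iInf_nonneg fun n => escProb_nonneg d A n z
  · exact le_rfl

lemma eqMeasure_le_one (d : ℕ) (A : Set (Zd d)) (z : Zd d) : eqMeasure d A z ≤ 1 := by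
  unfold eqMeasure
  split_ifs
  · exact ciInf_le ⟨0, by rintro _ ⟨n, rfl⟩; exact escProb_nonneg d A n z⟩ 0
  · exact zero_le_one

lemma poisson_hasSum (lam x : ℝ) :
    HasSum (fun n : ℕ => poissonProb lam n * x ^ n) (Real.exp (lam * (x - 1))) := by
  have h := (NormedSpace.expSeries_div_hasSum_exp (𝔸 := ℝ) (lam * x)).mul_left (Real.exp (-lam))
  rw [← Real.exp_eq_exp_ℝ, ← Real.exp_add] at h
  have e1 : -lam + lam * x = lam * (x - 1) := by ring
  have e2 : (fun n : ℕ => poissonProb lam n * x ^ n) =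
      fun i : ℕ => Real.exp (-lam) * ((lam * x) ^ i / i.factorial) := by
    funext n
    unfold poissonProb
    rw [mul_pow]; ring
  rw [e2, ← e1]
  exact h

lemma poisson_mean (lam : ℝ) (h : 0 ≤ lam) :
    ∑' n : ℕ, (n : ℝ≥0∞) * ENNReal.ofReal (poissonProb lam n) = ENNReal.ofReal lam := by
  rw [tsum_eq_zero_add' ENNReal.summable]
  have h0 : ∀ n : ℕ, 0 ≤ poissonProb lam n := fun n => by unfold poissonProb; positivity
  have : ∀ n : ℕ, ((n+1 : ℕ) : ℝ≥0∞) * ENNReal.ofReal (poissonProb lam (n+1)) =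
      ENNReal.ofReal lam * ENNReal.ofReal (poissonProb lam n) := by
    intro n
    rw [← ENNReal.ofReal_natCast, ← ENNReal.ofReal_mul (by positivity), ← ENNReal.ofReal_mul h]
    congr 1
    unfold poissonProb
    rw [Nat.factorial_succ]
    push_cast
    field_simp
    ring
  simp only [this]
  rw [ENNReal.tsum_mul_left]
  have hs := poisson_hasSum lam 1
  simp at hs
  rw [← ENNReal.ofReal_tsum_of_nonneg h0 hs.summable, hs.tsum_eq]
  simp
lemma level_main (d T : ℕ) (hd : 1 ≤ d) (hT : 1 ≤ T) (u : ℝ) (hu : 0 < u) {Ω : Type}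
    [MeasurableSpace Ω] (Q : Measure Ω) [IsProbabilityMeasure Q] (K : Finset (Zd d))
    (N : Ω → ℕ) (Y : ℕ → ℕ → Ω → Zd d) (h : HasLevelLaw d u Q (K : Set (Zd d)) N Y)
    (r : ℝ) (hr : 0 ≤ r) :
    (∫⁻ ω, (N ω : ℝ≥0∞) ∂Q ≤ ENNReal.ofReal u * K.card) ∧
    Q {ω | ∃ k < N ω, (fun t : Fin (T+1) => Y k t ω) ∈ badPaths d T K r} ≤
      ENNReal.ofReal u * K.card *
        ENNReal.ofReal (2 * d * (T+1) * Real.exp (- r^2 / (2 * T))) := by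
  obtain ⟨hYm, hNm, hlaw⟩ := h
  set lam := u * capacity d (K : Set (Zd d)) with hlam
  set ν := neqMeasure d (K : Set (Zd d)) with hν
  have hlam0 : 0 ≤ lam := by
    have h0 := hlaw 0 0 (fun _ _ => 0)
    have h1 : ENNReal.ofReal (poissonProb lam 0 * 1) ≤ 1 := by
      simp only [Finset.range_zero, Finset.prod_empty] at h0
      rw [← h0]; exact prob_le_one
    rw [ENNReal.ofReal_le_one] at h1
    simp [poissonProb] at h1
    exact h1
  have hcap : 0 ≤ capacity d (K : Set (Zd d)) := by
    by_contra hc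
    push Not at hc
    have := mul_neg_of_pos_of_neg hu hc
    linarith
  have hν0 : ∀ z, 0 ≤ ν z := fun z => div_nonneg (eqMeasure_nonneg _ _ _) hcap
  have hνK : ∀ z ∉ K, ν z = 0 := by
    intro z hz
    simp [hν, neqMeasure, eqMeasure, hz]
  have hpp : ∀ p : ℕ → Zd d, 0 ≤ pathProb d ν T p := by
    intro p
    unfold pathProb
    split_ifs
    · exact mul_nonneg (hν0 _) (by positivity)
    · exact le_rfl
  have hpois0 : ∀ n, 0 ≤ poissonProb lam n := fun n => by unfold poissonProb; positivity
  set μ := pathMeas d T ν with hμ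
  have hμu := pathMeas_univ_le d T ν K hνK hd
  have hfin : (∑ z ∈ K, ENNReal.ofReal (ν z)) < ∞ :=
    ENNReal.sum_lt_top.mpr fun z _ => ENNReal.ofReal_lt_top
  have : IsFiniteMeasure μ := ⟨lt_of_le_of_lt hμu hfin⟩
  have hlamν : ENNReal.ofReal lam * (∑ z ∈ K, ENNReal.ofReal (ν z)) ≤ ENNReal.ofReal u * K.card := by
    rw [Finset.mul_sum, mul_comm _ (K.card : ℝ≥0∞), ← nsmul_eq_mul]
    refine Finset.sum_le_card_nsmul _ _ _ fun z _ => ?_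
    rw [← ENNReal.ofReal_mul hlam0]
    refine ENNReal.ofReal_le_ofReal ?_
    have h1 := eqMeasure_le_one d (K : Set (Zd d)) z
    rw [hν, hlam, neqMeasure]
    by_cases hc : capacity d (K : Set (Zd d)) = 0
    · simp [hc, hu.le]
    · rw [mul_assoc, mul_div_cancel₀ _ hc]
      nlinarith
  have hjoint : ∀ (n : ℕ) (A : Set (Fin n → Fin (T+1) → Zd d)),
      Q ({ω | N ω = n} ∩ {ω | (fun (k : Fin n) (t : Fin (T+1)) => Y k t ω) ∈ A}) =
      ENNReal.ofReal (poissonProb lam n) * Measure.pi (fun _ : Fin n => μ) A := by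
    intro n A
    have := law_ext Q {ω | N ω = n} (fun ω (k : Fin n) (t : Fin (T+1)) => Y k t ω)
      (by
        refine measurable_pi_lambda _ fun k => measurable_pi_lambda _ fun t => hYm _ _)
      (ENNReal.ofReal (poissonProb lam n) • Measure.pi (fun _ : Fin n => μ)) ?_ A
    · rw [this, Measure.smul_apply, smul_eq_mul]
    · intro p
      have hl := hlaw n T (fun k => if hk : k < n then extPath (p ⟨k, hk⟩) else 0)
      rw [Measure.smul_apply, smul_eq_mul, Measure.pi_singleton]
      simp only [hμ, pathMeas_singleton]
      rw [← ENNReal.ofReal_prod_of_nonneg (fun _ _ => hpp _), ← ENNReal.ofReal_mul (hpois0 n)]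
      have e1 : ∏ k ∈ Finset.range n, pathProb d ν T
          (if hk : k < n then extPath (p ⟨k, hk⟩) else 0) =
          ∏ i : Fin n, pathProb d ν T (extPath (p i)) := by
        rw [Finset.prod_range]
        refine Finset.prod_congr rfl fun i _ => ?_
        simp
      rw [e1] at hl
      rw [← hl]
      congr 1
      ext ω
      simp only [Set.mem_inter_iff, Set.mem_ofPred_eq]
      refine and_congr_right fun _ => ?_
      constructor
      · intro hh k hk t ht
        rw [dif_pos hk, extPath_of_le _ _ ht, ← hh]
      · intro hh
        funext k t
        have := hh k k.2 t (Nat.le_of_lt_succ t.2)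
        rw [dif_pos k.2, extPath_of_le _ _ (Nat.le_of_lt_succ t.2)] at this
        exact this
  set S := μ Set.univ with hS
  have hN : ∀ n, Q {ω | N ω = n} = ENNReal.ofReal (poissonProb lam n) * S ^ n := by
    intro n
    have := hjoint n Set.univ
    simpa [Measure.pi_univ] using this
  have hmeasN : ∀ n, MeasurableSet {ω | N ω = n} := fun n => hNm (measurableSet_singleton n)
  have hsum1 : ∑' n, ENNReal.ofReal (poissonProb lam n) * S ^ n = 1 := by
    simp only [← hN]
    rw [← measure_iUnion _ hmeasN]
    · rw [show (⋃ n, {ω | N ω = n}) = Set.univ by ext; simp]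
      exact measure_univ
    · intro a b hab
      refine Set.disjoint_left.mpr fun ω h1 h2 => hab ?_
      rw [← h1, ← h2]
  have hSt : S ≠ ∞ := measure_ne_top μ _
  have hnorm : lam = 0 ∨ S = 1 := by
    have hs := poisson_hasSum lam S.toReal
    have e : ∀ n, ENNReal.ofReal (poissonProb lam n) * S ^ n =
        ENNReal.ofReal (poissonProb lam n * S.toReal ^ n) := by
      intro n
      rw [ENNReal.ofReal_mul (hpois0 n), ENNReal.ofReal_pow ENNReal.toReal_nonneg,
        ENNReal.ofReal_toReal hSt]
    simp only [e] at hsum1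
    rw [← ENNReal.ofReal_tsum_of_nonneg (fun n => mul_nonneg (hpois0 n) (by positivity)) hs.summable,
      hs.tsum_eq, ENNReal.ofReal_eq_one, Real.exp_eq_one_iff, mul_eq_zero] at hsum1
    refine hsum1.imp_right fun h1 => ?_
    rw [← ENNReal.ofReal_toReal hSt, show S.toReal = 1 by linarith]
    simp
  have hpl : ∀ n k : ℕ, (n : ℝ≥0∞) * (ENNReal.ofReal (poissonProb lam n) * S ^ k) =
      (n : ℝ≥0∞) * ENNReal.ofReal (poissonProb lam n) := by
    intro n k
    rcases hnorm with h0 | h1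
    · rcases Nat.eq_zero_or_pos n with hn | hn
      · simp [hn]
      · simp [poissonProb, h0, hn.ne']
    · simp [h1]
  have hlamS : ENNReal.ofReal lam ≤ ENNReal.ofReal lam * S := by
    rcases hnorm with h0 | h1
    · simp [h0]
    · simp [h1]
  constructor
  · have e : ∫⁻ ω, (N ω : ℝ≥0∞) ∂Q = ∑' n : ℕ, (n : ℝ≥0∞) * Q {ω | N ω = n} := by
      rw [← lintegral_map (f := fun n : ℕ => (n : ℝ≥0∞)) (g := N) (measurable_from_top) hNm,
        lintegral_countable']
      refine tsum_congr fun n => ?_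
      rw [Measure.map_apply hNm (measurableSet_singleton n)]
      rfl
    rw [e]
    simp only [hN, hpl]
    rw [poisson_mean lam hlam0]
    refine hlamS.trans (le_trans ?_ hlamν)
    gcongr
  · set B := badPaths d T (K : Set (Zd d)) r with hB
    have hone : ∀ (n : ℕ) (k : Fin n), Q ({ω | N ω = n} ∩ {ω | (fun t : Fin (T+1) => Y k t ω) ∈ B}) =
        ENNReal.ofReal (poissonProb lam n) * (μ B * S ^ (n-1)) := by
      intro n k
      have := hjoint n (Set.pi Set.univ (Function.update (fun _ => Set.univ) k B))
      rw [Measure.pi_pi] at this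
      have e : ∏ i : Fin n, μ (Function.update (fun _ => Set.univ) k B i) = μ B * S ^ (n-1) := by
        rw [← Finset.mul_prod_erase _ _ (Finset.mem_univ k)]
        congr 1
        · simp
        · rw [Finset.prod_congr rfl (g := fun _ => S)]
          · simp
          · intro i hi
            rw [Function.update_of_ne (Finset.ne_of_mem_erase hi)]
      rw [e] at this
      rw [← this]
      congr 2
      ext ω
      simp only [Set.mem_ofPred_eq, Set.mem_pi, Set.mem_univ, true_imp_iff]
      constructor
      · intro hh i
        by_cases hi : i = k
        · subst hi; simpa using hh
        · simp [Function.update_of_ne hi]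
      · intro hh
        simpa using hh k
    have hsub : {ω | ∃ k < N ω, (fun t : Fin (T+1) => Y k t ω) ∈ B} ⊆
        ⋃ n, ⋃ k : Fin n, ({ω | N ω = n} ∩ {ω | (fun t : Fin (T+1) => Y k t ω) ∈ B}) := by
      rintro ω ⟨k, hk, hb⟩
      simp only [Set.mem_iUnion]
      exact ⟨N ω, ⟨k, hk⟩, rfl, hb⟩
    calc _ ≤ ∑' n, ∑ k : Fin n, ENNReal.ofReal (poissonProb lam n) * (μ B * S ^ (n-1)) := by
          refine (measure_mono hsub).trans ((measure_iUnion_le _).trans ?_)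
          refine ENNReal.tsum_le_tsum fun n => ?_
          refine (measure_iUnion_fintype_le _ _).trans ?_
          refine Finset.sum_le_sum fun k _ => (hone n k).le
      _ = ∑' n : ℕ, (n : ℝ≥0∞) * ENNReal.ofReal (poissonProb lam n) * μ B := by
          refine tsum_congr fun n => ?_
          rw [← hpl n (n-1)]
          simp
          ring
      _ = ENNReal.ofReal lam * μ B := by
          rw [ENNReal.tsum_mul_right, poisson_mean lam hlam0]
      _ ≤ ENNReal.ofReal lam * ((∑ z ∈ K, ENNReal.ofReal (ν z)) *
          ENNReal.ofReal (2 * d * (T+1) * Real.exp (- r^2 / (2 * T)))) := by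
          gcongr
          exact pathMeas_bad_le d T hT ν K hνK hd r hr
      _ ≤ _ := by
          rw [← mul_assoc]
          gcongr

lemma srw_bad (d T : ℕ) (hd : 1 ≤ d) (hT : 1 ≤ T) {Ω : Type}
    [MeasurableSpace Ω] (P : Measure Ω) (X : ℕ → Ω → Zd d) (x : Zd d) (h : IsSRW d P X x)
    (r : ℝ) (hr : 0 ≤ r) :
    P {ω | (fun t : Fin (T+1) => X t ω) ∈ badPaths d T {x} r} ≤
        ENNReal.ofReal (2 * d * (T+1) * Real.exp (- r^2 / (2 * T))) := by
  classical
  have hl := law_ext P Set.univ (fun ω (t : Fin (T+1)) => X t ω)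
    (measurable_pi_lambda _ fun t => h.1 _) (pathMeas d T (fun z => if z = x then 1 else 0)) ?_
    (badPaths d T {x} r)
  · rw [Set.univ_inter] at hl
    rw [hl]
    have := pathMeas_bad_le d T hT (fun z => if z = x then 1 else 0) {x} (by simp) hd r hr
    simpa using this
  · intro p
    have := h.2 T (extPath p)
    rw [Set.univ_inter, pathMeas_singleton]
    have e : {ω | (fun t : Fin (T+1) => X t ω) = p} = {ω | ∀ k ≤ T, X k ω = extPath p k} := by
      ext ω
      constructor
      · intro hh k hk
        rw [extPath_of_le _ _ hk, ← (show _ = p from hh)]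
      · intro hh
        funext t
        have := hh t (Nat.le_of_lt_succ t.2)
        rwa [extPath_of_le _ _ (Nat.le_of_lt_succ t.2)] at this
    rw [e, this]
    have hd0 : (0:ℝ) < d := by exact_mod_cast hd
    unfold pathProb
    beta_reduce
    by_cases h1 : ∀ k < T, IsStep (extPath p k) (extPath p (k+1))
    · by_cases h2 : extPath p 0 = x
      · rw [if_pos ⟨h2, h1⟩, if_pos h1, if_pos h2, one_mul, ENNReal.ofReal_pow (by positivity),
          ENNReal.ofReal_inv_of_pos (by positivity), ENNReal.ofReal_mul (by norm_num)]
        simp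
      · rw [if_neg (fun hh => h2 hh.1), if_pos h1, if_neg h2]
        simp
    · rw [if_neg (fun hh => h1 hh.2), if_neg h1]
      simp
lemma Uset_card (d T : ℕ) {Ω : Type} (X : ℕ → Ω → Zd d) (N : ℕ → Ω → ℕ)
    (Y : ℕ → ℕ → ℕ → Ω → Zd d) (i : ℕ) (ω : Ω) :
    (Uset d T X N Y i ω).Finite ∧
      (Uset d T X N Y i ω).ncard ≤ if i ≤ 1 then T else N i ω * T := by
  classical
  unfold Uset
  split_ifs with h
  · have e : {z | ∃ t, 1 ≤ t ∧ t ≤ T ∧ X t ω = z} =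
        (((Finset.Icc 1 T).image fun t => X t ω : Finset (Zd d)) : Set (Zd d)) := by
      ext z
      simp only [Set.mem_ofPred_eq, Finset.coe_image, Set.mem_image, Finset.coe_Icc, Set.mem_Icc, and_assoc]
    rw [e]
    refine ⟨Finset.finite_toSet _, ?_⟩
    rw [Set.ncard_coe_finset]
    exact Finset.card_image_le.trans (by simp)
  · have e : {z | ∃ k < N i ω, ∃ t, 1 ≤ t ∧ t ≤ T ∧ Y i k t ω = z} =
        (((Finset.range (N i ω) ×ˢ Finset.Icc 1 T).image fun q => Y i q.1 q.2 ω : Finset (Zd d)) : Set (Zd d)) := by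
      ext z
      simp only [Set.mem_ofPred_eq, Finset.coe_image, Set.mem_image, Finset.mem_coe, Finset.mem_product,
        Finset.mem_range, Finset.mem_Icc, Prod.exists]
      constructor
      · rintro ⟨k, hk, t, h1, h2, h3⟩
        exact ⟨k, t, ⟨hk, h1, h2⟩, h3⟩
      · rintro ⟨k, t, ⟨hk, h1, h2⟩, h3⟩
        exact ⟨k, hk, t, h1, h2, h3⟩
    rw [e]
    refine ⟨Finset.finite_toSet _, ?_⟩
    rw [Set.ncard_coe_finset]
    exact Finset.card_image_le.trans (by simp)

lemma meas_mem_Uset (d T : ℕ) {Ω : Type} [MeasurableSpace Ω] (X : ℕ → Ω → Zd d) (N : ℕ → Ω → ℕ)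
    (Y : ℕ → ℕ → ℕ → Ω → Zd d) (i : ℕ) (hX : ∀ t, Measurable (X t))
    (hN : 2 ≤ i → Measurable (N i)) (hY : 2 ≤ i → ∀ k t, Measurable (Y i k t)) (z : Zd d) :
    MeasurableSet {ω | z ∈ Uset d T X N Y i ω} := by
  by_cases h : i ≤ 1
  · have e : {ω | z ∈ Uset d T X N Y i ω} = ⋃ t ∈ Set.Icc 1 T, (X t) ⁻¹' {z} := by
      ext ω
      simp [Uset, h, and_assoc]
    rw [e]
    exact MeasurableSet.biUnion (Set.to_countable _) fun t _ => hX t (measurableSet_singleton z)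
  · have h2 : 2 ≤ i := by omega
    have e : {ω | z ∈ Uset d T X N Y i ω} = ⋃ k, (N i ⁻¹' Set.Ioi k ∩
        ⋃ t ∈ Set.Icc 1 T, (Y i k t) ⁻¹' {z}) := by
      ext ω
      simp [Uset, h, and_assoc]
    rw [e]
    exact MeasurableSet.iUnion fun k => (hN h2 (MeasurableSet.of_discrete)).inter
      (MeasurableSet.biUnion (Set.to_countable _) fun t _ => hY h2 k t (measurableSet_singleton z))

lemma meas_Uset_eq (d T : ℕ) {Ω : Type} [MeasurableSpace Ω] (X : ℕ → Ω → Zd d) (N : ℕ → Ω → ℕ)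
    (Y : ℕ → ℕ → ℕ → Ω → Zd d) (i : ℕ) (hX : ∀ t, Measurable (X t))
    (hN : 2 ≤ i → Measurable (N i)) (hY : 2 ≤ i → ∀ k t, Measurable (Y i k t)) (F : Set (Zd d)) :
    MeasurableSet {ω | Uset d T X N Y i ω = F} := by
  have e : {ω | Uset d T X N Y i ω = F} = ⋂ z, {ω | z ∈ Uset d T X N Y i ω ↔ z ∈ F} := by
    ext ω
    simp [Set.ext_iff]
  rw [e]
  refine MeasurableSet.iInter fun z => ?_
  have := meas_mem_Uset d T X N Y i hX hN hY z
  by_cases hz : z ∈ F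
  · simp only [hz, iff_true]
    exact this
  · simp only [hz, iff_false]
    exact this.compl

/-- history built from finite data -/
def histSet {d n : ℕ} (κ : Fin n → Finset (Zd d)) (j : ℕ) : Set (Zd d) :=
  if h : j - 1 < n then (κ ⟨j - 1, h⟩ : Set (Zd d)) else ∅

lemma level_step (d T : ℕ) (hd : 1 ≤ d) (hT : 1 ≤ T) (u : ℝ) (hu : 0 < u) {Ω : Type}
    [MeasurableSpace Ω] (P : Measure Ω) [IsProbabilityMeasure P] (X : ℕ → Ω → Zd d) (N : ℕ → Ω → ℕ)
    (Y : ℕ → ℕ → ℕ → Ω → Zd d) (n : ℕ) (hn : 1 ≤ n) (hX : ∀ t, Measurable (X t))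
    (hN : ∀ j, 2 ≤ j → j ≤ n → Measurable (N j))
    (hY : ∀ j, 2 ≤ j → j ≤ n → ∀ k t, Measurable (Y j k t))
    (hlaw : ∀ 𝒦 : ℕ → Set (Zd d),
      P {ω | ∀ j, 1 ≤ j → j < n + 1 → Uset d T X N Y j ω = 𝒦 j} ≠ 0 →
      HasLevelLaw d u (P[|{ω | ∀ j, 1 ≤ j → j < n + 1 → Uset d T X N Y j ω = 𝒦 j}])
        (𝒦 n) (N (n+1)) (Y (n+1)))
    (r : ℝ) (hr : 0 ≤ r) :
    Measurable (N (n+1)) ∧ (∀ k t, Measurable (Y (n+1) k t)) ∧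
    (∫⁻ ω, (N (n+1) ω : ℝ≥0∞) ∂P ≤
      ENNReal.ofReal u * ∫⁻ ω, ((Uset d T X N Y n ω).ncard : ℝ≥0∞) ∂P) ∧
    P {ω | ∃ k < N (n+1) ω, (fun t : Fin (T+1) => Y (n+1) k t ω) ∈
        badPaths d T (Uset d T X N Y n ω) r} ≤
      ENNReal.ofReal u * (∫⁻ ω, ((Uset d T X N Y n ω).ncard : ℝ≥0∞) ∂P) *
        ENNReal.ofReal (2 * d * (T+1) * Real.exp (- r^2 / (2 * T))) := by
  classical
  set q := ENNReal.ofReal (2 * d * (T+1) * Real.exp (- r^2 / (2 * T))) with hq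
  set E : (Fin n → Finset (Zd d)) → Set Ω := fun κ =>
    {ω | ∀ j, 1 ≤ j → j < n + 1 → Uset d T X N Y j ω = histSet κ j} with hE
  have hEm : ∀ κ, MeasurableSet (E κ) := by
    intro κ
    have e : E κ = ⋂ j, ⋂ (_ : 1 ≤ j), ⋂ (_ : j < n+1), {ω | Uset d T X N Y j ω = histSet κ j} := by
      ext ω; simp [hE]
    rw [e]
    exact MeasurableSet.iInter fun j => MeasurableSet.iInter fun h1 => MeasurableSet.iInter fun h2 =>
      meas_Uset_eq d T X N Y j hX (fun h => hN j h (by omega)) (fun h => hY j h (by omega)) _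
  have hcover : (⋃ κ, E κ) = Set.univ := by
    refine Set.eq_univ_of_forall fun ω => Set.mem_iUnion.mpr ?_
    refine ⟨fun j => (Uset_card d T X N Y (j+1) ω).1.toFinset, ?_⟩
    intro j h1 h2
    have h3 : j - 1 < n := by omega
    have h4 : j - 1 + 1 = j := by omega
    simp [histSet, h3, h4]
  have hdisj : Pairwise (Function.onFun Disjoint E) := by
    intro κ κ' hne
    refine Set.disjoint_left.mpr fun ω h1 h2 => hne ?_
    funext j
    have e1 := h1 (j+1) (by omega) (by omega)
    have e2 := h2 (j+1) (by omega) (by omega)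
    rw [e1] at e2
    simpa [histSet] using e2
  have hlast : ∀ κ : Fin n → Finset (Zd d), histSet κ n = (κ ⟨n-1, by omega⟩ : Set (Zd d)) := by
    intro κ
    have : n - 1 < n := by omega
    simp [histSet, this]
  have hL : ∀ κ, P (E κ) ≠ 0 →
      HasLevelLaw d u (P[|E κ]) (κ ⟨n-1, by omega⟩ : Set (Zd d)) (N (n+1)) (Y (n+1)) := by
    intro κ h
    rw [← hlast κ]
    exact hlaw (histSet κ) h
  have hex : ∃ κ, P (E κ) ≠ 0 := by
    by_contra! hc
    have : P (⋃ κ, E κ) = 0 := measure_iUnion_null hc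
    rw [hcover] at this
    simp at this
  obtain ⟨κ₀, hκ₀⟩ := hex
  have hNm : Measurable (N (n+1)) := (hL κ₀ hκ₀).2.1
  refine ⟨hNm, (hL κ₀ hκ₀).1, ?_⟩
  have hcard : ∑' κ, P (E κ) * ((κ ⟨n-1, by omega⟩).card : ℝ≥0∞) =
      ∫⁻ ω, ((Uset d T X N Y n ω).ncard : ℝ≥0∞) ∂P := by
    rw [← setLIntegral_univ, ← hcover, lintegral_iUnion hEm hdisj]
    refine tsum_congr fun κ => ?_
    rw [setLIntegral_congr_fun (hEm κ) (g := fun _ => ((κ ⟨n-1, by omega⟩).card : ℝ≥0∞))]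
    · rw [setLIntegral_const, mul_comm]
    · intro ω hω
      have := hω n hn (by omega)
      simp only [this, hlast, Set.ncard_coe_finset]
  constructor
  · rw [← setLIntegral_univ, ← hcover, lintegral_iUnion hEm hdisj, ← hcard,
      ← ENNReal.tsum_mul_left]
    refine ENNReal.tsum_le_tsum fun κ => ?_
    by_cases h0 : P (E κ) = 0
    · rw [setLIntegral_measure_zero _ _ h0]; exact zero_le
    · have := cond_isProbabilityMeasure h0
      have hm := (level_main d T hd hT u hu (P[|E κ]) _ _ _ (hL κ h0) r hr).1
      rw [ProbabilityTheory.cond, lintegral_smul_measure, smul_eq_mul] at hm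
      calc _ = P (E κ) * ((P (E κ))⁻¹ * ∫⁻ ω in E κ, (N (n+1) ω : ℝ≥0∞) ∂P) := by
            rw [← mul_assoc, ENNReal.mul_inv_cancel h0 (measure_ne_top _ _), one_mul]
        _ ≤ P (E κ) * (ENNReal.ofReal u * ((κ ⟨n-1, by omega⟩).card : ℝ≥0∞)) := by gcongr
        _ = _ := by ring
  · set B := {ω | ∃ k < N (n+1) ω, (fun t : Fin (T+1) => Y (n+1) k t ω) ∈
        badPaths d T (Uset d T X N Y n ω) r} with hB
    have hsub : B ⊆ ⋃ κ, (E κ ∩ B) := by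
      rw [← Set.iUnion_inter, hcover, Set.univ_inter]
    refine (measure_mono hsub).trans ((measure_iUnion_le _).trans ?_)
    rw [← hcard, ← ENNReal.tsum_mul_left, ← ENNReal.tsum_mul_right]
    refine ENNReal.tsum_le_tsum fun κ => ?_
    by_cases h0 : P (E κ) = 0
    · rw [measure_mono_null Set.inter_subset_left h0]; exact zero_le
    · have := cond_isProbabilityMeasure h0
      have hm := (level_main d T hd hT u hu (P[|E κ]) _ _ _ (hL κ h0) r hr).2
      rw [cond_apply (hEm κ)] at hm
      have e : E κ ∩ B = E κ ∩ {ω | ∃ k < N (n+1) ω, (fun t : Fin (T+1) => Y (n+1) k t ω) ∈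
          badPaths d T (κ ⟨n-1, by omega⟩ : Set (Zd d)) r} := by
        ext ω
        refine and_congr_right fun hω => ?_
        have := hω n hn (by omega)
        rw [hlast] at this
        simp only [hB, Set.mem_ofPred_eq, this]
      rw [e]
      calc _ = P (E κ) * ((P (E κ))⁻¹ * P (E κ ∩ {ω | ∃ k < N (n+1) ω,
            (fun t : Fin (T+1) => Y (n+1) k t ω) ∈
              badPaths d T (κ ⟨n-1, by omega⟩ : Set (Zd d)) r})) := by
            rw [← mul_assoc, ENNReal.mul_inv_cancel h0 (measure_ne_top _ _), one_mul]
        _ ≤ P (E κ) * (ENNReal.ofReal u * ((κ ⟨n-1, by omega⟩).card : ℝ≥0∞) * q) := by gcongr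
        _ = _ := by ring
/-- the bad event at level `i` -/
def badLevel (d T : ℕ) {Ω : Type} (X : ℕ → Ω → Zd d) (N : ℕ → Ω → ℕ)
    (Y : ℕ → ℕ → ℕ → Ω → Zd d) (x : Zd d) (r : ℝ) : ℕ → Set Ω
  | 0 => {ω | (fun t : Fin (T+1) => X t ω) ∈ badPaths d T {x} r}
  | n+1 => {ω | ∃ k < N (n+2) ω, (fun t : Fin (T+1) => Y (n+2) k t ω) ∈
        badPaths d T (Uset d T X N Y (n+1) ω) r}

lemma good_subset (d T : ℕ) {Ω : Type} (X : ℕ → Ω → Zd d) (N : ℕ → Ω → ℕ)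
    (Y : ℕ → ℕ → ℕ → Ω → Zd d) (x : Zd d) (r : ℝ) (ω : Ω) (n : ℕ)
    (h : ∀ i ≤ n, ω ∉ badLevel d T X N Y x r i) :
    Uset d T X N Y (n+1) ω ⊆ ballZR d (fun j => (x j : ℝ)) ((n+1 : ℕ) * r) := by
  induction n with
  | zero =>
    intro z hz j
    have h0 := h 0 le_rfl
    simp only [Uset, zero_add, le_refl, if_true, Set.mem_ofPred_eq] at hz
    obtain ⟨t, h1, h2, rfl⟩ := hz
    simp only [badLevel, badPaths, Set.mem_ofPred_eq, not_or, not_not, not_exists, not_lt,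
      Set.mem_singleton_iff] at h0
    have h3 := h0.2 ⟨t, by omega⟩ j
    rw [h0.1] at h3
    simpa using h3
  | succ n ih =>
    have ih := ih fun i hi => h i (by omega)
    intro z hz j
    have h0 := h (n+1) le_rfl
    have hn : ¬ (n + 1 + 1 ≤ 1) := by omega
    simp only [Uset, if_neg hn, Set.mem_ofPred_eq] at hz
    obtain ⟨k, hk, t, h1, h2, rfl⟩ := hz
    simp only [badLevel, badPaths, Set.mem_ofPred_eq, not_or, not_not, not_exists, not_lt, not_and] at h0
    obtain ⟨h3, h4⟩ := h0 k hk
    have h5 := ih h3 j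
    have h6 := h4 ⟨t, by omega⟩ j
    have h7 := abs_sub_le ((Y (n+1+1) k t ω j : ℤ) : ℝ) (Y (n+2) k ((0 : Fin (T+1)) : ℕ) ω j : ℤ) (x j)
    push_cast at h5 ⊢
    simp only at h6
    linarith

lemma all_levels (d T : ℕ) (hd : 1 ≤ d) (hT : 1 ≤ T) (u : ℝ) (hu : 0 < u) {Ω : Type}
    [MeasurableSpace Ω] (P : Measure Ω) [IsProbabilityMeasure P] (X : ℕ → Ω → Zd d) (N : ℕ → Ω → ℕ)
    (Y : ℕ → ℕ → ℕ → Ω → Zd d) (x : Zd d) (s : ℕ) (hX : IsSRW d P X x)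
    (hlaw : ∀ i, 2 ≤ i → i ≤ s → ∀ 𝒦 : ℕ → Set (Zd d),
      P {ω | ∀ j, 1 ≤ j → j < i → Uset d T X N Y j ω = 𝒦 j} ≠ 0 →
      HasLevelLaw d u (P[|{ω | ∀ j, 1 ≤ j → j < i → Uset d T X N Y j ω = 𝒦 j}])
        (𝒦 (i-1)) (N i) (Y i))
    (r : ℝ) (hr : 0 ≤ r) (n : ℕ) (hn : n + 1 ≤ s) :
    (∀ j, 2 ≤ j → j ≤ n+1 → Measurable (N j) ∧ ∀ k t, Measurable (Y j k t)) ∧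
    (∫⁻ ω, ((Uset d T X N Y (n+1) ω).ncard : ℝ≥0∞) ∂P ≤ (ENNReal.ofReal u * T)^n * T) ∧
    P (badLevel d T X N Y x r n) ≤ (ENNReal.ofReal u * T)^n *
        ENNReal.ofReal (2 * d * (T+1) * Real.exp (- r^2 / (2 * T))) := by
  induction n with
  | zero =>
    refine ⟨fun j h1 h2 => by omega, ?_, ?_⟩
    · calc _ ≤ ∫⁻ ω, (T : ℝ≥0∞) ∂P := by
            refine lintegral_mono fun ω => ?_
            have := (Uset_card d T X N Y 1 ω).2
            simp only [le_refl, if_true] at this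
            simpa using this
        _ = _ := by simp
    · have := srw_bad d T hd hT P X x hX r hr
      simpa [badLevel] using this
  | succ n ih =>
    obtain ⟨hm, hc, -⟩ := ih (by omega)
    obtain ⟨g1, g2, g3, g4⟩ := level_step d T hd hT u hu P X N Y (n+1) (by omega) hX.1
      (fun j h1 h2 => (hm j h1 h2).1) (fun j h1 h2 => (hm j h1 h2).2)
      (fun 𝒦 h => hlaw (n+1+1) (by omega) hn 𝒦 h) r hr
    refine ⟨?_, ?_, ?_⟩
    · intro j h1 h2
      rcases Nat.lt_or_ge (n+1) j with h | h
      · have : j = n+1+1 := by omega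
        subst this
        exact ⟨g1, g2⟩
      · exact hm j h1 h
    · calc _ ≤ ∫⁻ ω, (N (n+1+1) ω : ℝ≥0∞) * T ∂P := by
            refine lintegral_mono fun ω => ?_
            have := (Uset_card d T X N Y (n+1+1) ω).2
            rw [if_neg (by omega)] at this
            calc ((Uset d T X N Y (n+1+1) ω).ncard : ℝ≥0∞) ≤ ((N (n+1+1) ω * T : ℕ) : ℝ≥0∞) :=
                  Nat.cast_le.mpr this
              _ = _ := by push_cast; rfl
        _ = (∫⁻ ω, (N (n+1+1) ω : ℝ≥0∞) ∂P) * T := lintegral_mul_const' _ _ (by simp)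
        _ ≤ (ENNReal.ofReal u * ((ENNReal.ofReal u * T)^n * T)) * T := by
            gcongr
            exact g3.trans (by gcongr)
        _ = _ := by ring
    · refine (show P (badLevel d T X N Y x r (n+1)) ≤ _ from g4).trans ?_
      gcongr
      calc _ ≤ ENNReal.ofReal u * ((ENNReal.ofReal u * T)^n * T) := by gcongr
        _ = _ := by ring

lemma poly_exp (γ : ℝ) (hγ : 0 < γ) (m : ℕ) : ∃ C : ℝ, 0 < C ∧ ∀ T : ℕ, 1 ≤ T →
    (T:ℝ)^m * Real.exp (-(T:ℝ)^γ/2) ≤ C * Real.exp (-(1/4) * (T:ℝ)^γ) := by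
  obtain ⟨k, hk⟩ := exists_nat_ge ((m:ℝ)/γ)
  refine ⟨4^k * k.factorial, by positivity, fun T hT => ?_⟩
  have hT1 : (1:ℝ) ≤ T := by exact_mod_cast hT
  set y := (T:ℝ)^γ with hy
  have hy0 : 0 ≤ y := by positivity
  have h1 : (T:ℝ)^m ≤ y^k := by
    rw [hy, ← Real.rpow_natCast, ← Real.rpow_natCast, ← Real.rpow_mul (by positivity)]
    refine Real.rpow_le_rpow_of_exponent_le hT1 ?_
    rw [div_le_iff₀ hγ] at hk
    linarith
  have h2 := Real.pow_div_factorial_le_exp (x := y/4) (by positivity) k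
  rw [div_le_iff₀ (by positivity), div_pow, div_le_iff₀ (by positivity)] at h2
  have e : Real.exp (-(1/4) * y) = Real.exp (y/4) * Real.exp (-y/2) := by
    rw [← Real.exp_add]; congr 1; ring
  rw [e, ← mul_assoc]
  gcongr
  linarith

/-- For `d ≥ 3`, `u > 0`, `γ ∈ (0,1)` and a positive integer `s`, there are constants
`c > 0`, `C < ∞` such that for every `x ∈ ℤ^d` and positive integer `T`, the recursively
defined random sets `U⁽¹⁾, …, U⁽ˢ⁾` (`U⁽¹⁾` the range of a simple random walk from `x` on
times `1, …, T`; given the history, level `i` consists of a Poisson(`u·cap(U⁽ⁱ⁻¹⁾)`) number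
of independent walks started i.i.d. from the normalized equilibrium measure of `U⁽ⁱ⁻¹⁾`)
satisfy `P[⋃_{i≤s} U⁽ⁱ⁾ ⊆ B(x, s T^{(1+γ)/2})] ≥ 1 - C exp(-c T^γ)`. -/
theorem Uset_subset_ball (d : ℕ) (hd : 3 ≤ d) (u : ℝ) (hu : 0 < u)
    (γ : ℝ) (hγ : γ ∈ Set.Ioo (0:ℝ) 1) (s : ℕ) (hs : 1 ≤ s) :
    ∃ c C : ℝ, 0 < c ∧ 0 < C ∧
    ∀ (x : Zd d) (T : ℕ), 1 ≤ T →
    ∀ (Ω : Type) (_ : MeasurableSpace Ω) (P : Measure Ω), IsProbabilityMeasure P →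
    ∀ (X : ℕ → Ω → Zd d) (N : ℕ → Ω → ℕ) (Y : ℕ → ℕ → ℕ → Ω → Zd d),
    IsSRW d P X x →
    (∀ i, 2 ≤ i → i ≤ s → ∀ 𝒦 : ℕ → Set (Zd d),
      P {ω | ∀ j, 1 ≤ j → j < i → Uset d T X N Y j ω = 𝒦 j} ≠ 0 →
      HasLevelLaw d u (P[|{ω | ∀ j, 1 ≤ j → j < i → Uset d T X N Y j ω = 𝒦 j}])
        (𝒦 (i-1)) (N i) (Y i)) →
    1 - ENNReal.ofReal (C * Real.exp (-c * (T : ℝ) ^ γ)) ≤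
      P {ω | ∀ i, 1 ≤ i → i ≤ s →
          Uset d T X N Y i ω ⊆
            ballZR d (fun j => (x j : ℝ)) ((s : ℝ) * (T : ℝ) ^ ((1 + γ) / 2))} := by
  obtain ⟨C₀, hC₀, hpoly⟩ := poly_exp γ hγ.1 (s+1)
  refine ⟨1/4, s * ((1 + u)^s * (4 * d)) * C₀, by norm_num, ?_, ?_⟩
  · have : 0 < d := by omega
    have : 0 < s := by omega
    positivity
  intro x T hT Ω _ P hP X N Y hX hlaw
  set r : ℝ := (T:ℝ)^((1+γ)/2) with hr
  have hT1 : (1:ℝ) ≤ T := by exact_mod_cast hT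
  have hr0 : 0 ≤ r := by positivity
  have hrT : -r^2/(2*T) = -(T:ℝ)^γ/2 := by
    have : r^2 = T * (T:ℝ)^γ := by
      rw [hr, ← Real.rpow_natCast, ← Real.rpow_mul (by positivity)]
      have : (1+γ)/2 * ((2:ℕ):ℝ) = 1 + γ := by push_cast; ring
      rw [this, Real.rpow_add (by positivity), Real.rpow_one]
    rw [this]
    field_simp
  set G := {ω | ∀ i, 1 ≤ i → i ≤ s →
          Uset d T X N Y i ω ⊆ ballZR d (fun j => (x j : ℝ)) ((s : ℝ) * r)} with hG
  have hsub : Gᶜ ⊆ ⋃ n ∈ Finset.range s, badLevel d T X N Y x r n := by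
    intro ω hω
    by_contra hc
    simp only [Set.mem_iUnion, not_exists, Finset.mem_range] at hc
    apply hω
    intro i h1 h2 z hz j
    obtain ⟨n, rfl⟩ : ∃ n, i = n + 1 := ⟨i - 1, by omega⟩
    have := good_subset d T X N Y x r ω n (fun i hi => hc i (by omega)) hz j
    refine this.trans ?_
    gcongr
  have hbad : P Gᶜ ≤ ENNReal.ofReal
      (s * ((1 + u)^s * (4 * d)) * C₀ * Real.exp (-(1/4) * (T:ℝ)^γ)) := by
    refine (measure_mono hsub).trans ((measure_biUnion_finset_le _ _).trans ?_)
    have hone : ∀ n ∈ Finset.range s, P (badLevel d T X N Y x r n) ≤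
        ENNReal.ofReal ((1 + u)^s * (4 * d) * (C₀ * Real.exp (-(1/4) * (T:ℝ)^γ))) := by
      intro n hn
      rw [Finset.mem_range] at hn
      refine (all_levels d T (by omega) hT u hu P X N Y x s hX hlaw r hr0 n hn).2.2.trans ?_
      rw [← ENNReal.ofReal_natCast T, ← ENNReal.ofReal_mul hu.le, ← ENNReal.ofReal_pow (by positivity),
        ← ENNReal.ofReal_mul (by positivity), hrT]
      refine ENNReal.ofReal_le_ofReal ?_
      have h1 : (u * T)^n ≤ (1+u)^s * (T:ℝ)^s := by
        rw [mul_pow]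
        have : u^n ≤ (1+u)^s :=
          (pow_le_pow_left₀ hu.le (by linarith) n).trans (pow_le_pow_right₀ (by linarith) hn.le)
        have h2 : (T:ℝ)^n ≤ (T:ℝ)^s := pow_le_pow_right₀ hT1 hn.le
        gcongr
      calc _ ≤ ((1+u)^s * (T:ℝ)^s) * (2 * d * (T+T) * Real.exp (-(T:ℝ)^γ/2)) := by gcongr
        _ = (1+u)^s * (4 * d) * ((T:ℝ)^(s+1) * Real.exp (-(T:ℝ)^γ/2)) := by ring
        _ ≤ _ := by
          have := hpoly T hT
          gcongr
    refine (Finset.sum_le_card_nsmul _ _ _ hone).trans (le_of_eq ?_)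
    rw [Finset.card_range, nsmul_eq_mul, ← ENNReal.ofReal_natCast s, ← ENNReal.ofReal_mul (by positivity)]
    congr 1
    ring
  rw [tsub_le_iff_right]
  calc (1:ℝ≥0∞) = P (G ∪ Gᶜ) := by rw [Set.union_compl_self, measure_univ]
    _ ≤ P G + P Gᶜ := measure_union_le _ _
    _ ≤ _ := by gcongr
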